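/- arXiv:1912.04537 — 2 statements merged into one kernel-verified Lean document; each statement's English description precedes it below -/
import Mathlib

section
/- Quantitative Voronovskaya-type theorem: Let a > 1, fix x ≥ 0, and let g : [0,∞) → ℝ be twice continuously differentiable with |g(t)| ≤ M(1 + t²), |g'(t)| ≤ M(1 + t²) and |g''(t)| ≤ M(1 + t²) for all t ≥ 0 and some constant M > 0. Then there exist a constant C > 0 and an integer m₀ ≥ 1 such that for all integers m ≥ m₀, m·|R̂_{m,a}(g; x) − g(x) − g'(x)·Λ¹_m(x) − (g''(x)/2)·Λ²_m(x)| ≤ C·Δ(g''; m^{−1/2}), where Δ(h; ξ) := sup{ |h(s + t) − h(s)|/((1 + t²)(1 + s²)) : 0 < t ≤ ξ, s ≥ 0 } is the weighted modulus of continuity. -/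
open Real MeasureTheory Filter

/-- The modified Szász–Mirakjan–Kantorovich operator of Mishra and Yadav. -/
noncomputable def szaszKant (a : ℝ) (m : ℕ) (f : ℝ → ℝ) (x : ℝ) : ℝ :=
  (m : ℝ) * ∑' k : ℕ,
    Real.exp (-(x * Real.log a / (a ^ ((1 : ℝ) / (m : ℝ)) - 1))) *
      (x * Real.log a / (a ^ ((1 : ℝ) / (m : ℝ)) - 1)) ^ k / (Nat.factorial k : ℝ) *
      ∫ t in ((k : ℝ) / (m : ℝ))..(((k : ℝ) + 1) / (m : ℝ)), f t

/-- The `n`-th central moment of the operator. -/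
noncomputable def szaszKantCM (a : ℝ) (m : ℕ) (n : ℕ) (x : ℝ) : ℝ :=
  szaszKant a m (fun t => (t - x) ^ n) x

/-- The weighted modulus of continuity of Ispir. -/
noncomputable def wMod (h : ℝ → ℝ) (ξ : ℝ) : ℝ :=
  sSup {r : ℝ | ∃ s t : ℝ, 0 ≤ s ∧ 0 < t ∧ t ≤ ξ ∧
    r = |h (s + t) - h s| / ((1 + t ^ 2) * (1 + s ^ 2))}

/-- The Poisson generating function. -/
theorem sk_poisson_exp (l s : ℝ) :
    HasSum (fun k : ℕ => Real.exp (-l) * l ^ k / (Nat.factorial k : ℝ) * Real.exp (s * (k - l)))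
      (Real.exp (l * (Real.exp s - 1 - s))) := by
  have h := (NormedSpace.expSeries_div_hasSum_exp (l * Real.exp s)).mul_left
    (Real.exp (-l) * Real.exp (-(s * l)))
  rw [← Real.exp_eq_exp_ℝ, ← Real.exp_add, ← Real.exp_add] at h
  have e : -l + -(s * l) + l * Real.exp s = l * (Real.exp s - 1 - s) := by ring
  rw [e] at h
  refine h.congr_fun ?_
  intro k
  have : Real.exp (s * (k - l)) = Real.exp (-(s * l)) * Real.exp s ^ k := by
    rw [← Real.exp_nat_mul, ← Real.exp_add]; congr 1; ring
  rw [this, Real.exp_add, mul_pow]; ring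

/-- Poisson exponential moments at scale `s`. -/
theorem sk_poisson_exp_le (l s x : ℝ) (hl : 0 ≤ l) (hs : |s| ≤ 1) (h : l * s ^ 2 ≤ x) :
    Real.exp (l * (Real.exp s - 1 - s)) ≤ Real.exp x := by
  apply Real.exp_le_exp.2
  have := (abs_le.1 (Real.abs_exp_sub_one_sub_id_le hs)).2
  nlinarith

/-- The parameter satisfies `0 ≤ l ≤ m x` and `m x - l ≤ x log a`. -/
theorem sk_param (a : ℝ) (ha : 1 < a) (x : ℝ) (hx : 0 ≤ x) (m : ℕ) (hm : 1 ≤ m) :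
    0 ≤ x * Real.log a / (a ^ ((1 : ℝ) / (m : ℝ)) - 1) ∧
    x * Real.log a / (a ^ ((1 : ℝ) / (m : ℝ)) - 1) ≤ m * x ∧
    m * x - x * Real.log a / (a ^ ((1 : ℝ) / (m : ℝ)) - 1) ≤ x * Real.log a := by
  have hm0 : (0 : ℝ) < m := by exact_mod_cast hm
  have hL : 0 < Real.log a := Real.log_pos ha
  obtain ⟨u, hu⟩ : ∃ u, u = Real.log a / m := ⟨_, rfl⟩
  have hu0 : 0 < u := by rw [hu]; positivity
  have hLu : Real.log a = m * u := by rw [hu]; field_simp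
  have e : a ^ ((1 : ℝ) / (m : ℝ)) = Real.exp u := by
    rw [Real.rpow_def_of_pos (by linarith), hu]; congr 1; ring
  rw [e, hLu]
  have h1 : u + 1 ≤ Real.exp u := Real.add_one_le_exp u
  have hp : 0 < Real.exp u - 1 := by linarith
  have h2 : Real.exp u - 1 ≤ u * Real.exp u := by
    have h3 := Real.add_one_le_exp (-u)
    have h4 : Real.exp (-u) * Real.exp u = 1 := by rw [← Real.exp_add]; simp
    nlinarith [Real.exp_pos u]
  refine ⟨by positivity, ?_, ?_⟩
  · rw [div_le_iff₀ hp]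
    have : 0 ≤ m * x := by positivity
    nlinarith
  · rw [sub_le_comm, le_div_iff₀ hp]
    have h5 : 0 ≤ m * x := by positivity
    have h6 : (1 - u) * (Real.exp u - 1) ≤ u := by nlinarith
    nlinarith

theorem sk_summable (l : ℝ) (hl : 0 ≤ l) (m : ℕ) (hm : 1 ≤ m) (f : ℝ → ℝ) (A : ℝ)
    (hf : ∀ t, 0 ≤ t → |f t| ≤ A * (1 + t ^ 2)) :
    Summable (fun k : ℕ => Real.exp (-l) * l ^ k / (Nat.factorial k : ℝ) *
      ∫ t in ((k : ℝ) / (m : ℝ))..(((k : ℝ) + 1) / (m : ℝ)), f t) := by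
  have hm0 : (1 : ℝ) ≤ m := by exact_mod_cast hm
  have hA : 0 ≤ A := by
    have := (abs_nonneg _).trans (hf 0 le_rfl); simpa using this
  have h := ((sk_poisson_exp l 1).summable.mul_right (A * 2 * Real.exp (1 + l)))
  refine Summable.of_norm_bounded h ?_
  intro k
  have hk : (0 : ℝ) ≤ k := Nat.cast_nonneg k
  have hI : ‖∫ t in ((k : ℝ) / (m : ℝ))..(((k : ℝ) + 1) / (m : ℝ)), f t‖ ≤
      A * (2 * Real.exp (k + 1)) * |((k : ℝ) + 1) / (m : ℝ) - (k : ℝ) / (m : ℝ)| := by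
    apply intervalIntegral.norm_integral_le_of_norm_le_const
    intro t ht
    rw [Set.uIoc_of_le (by gcongr; linarith)] at ht
    have ht0 : 0 ≤ t := le_trans (by positivity) ht.1.le
    have ht1 : t ≤ k + 1 := ht.2.trans (div_le_self (by positivity) hm0)
    refine (hf t ht0).trans ?_
    gcongr
    have h2 := Real.quadratic_le_exp_of_nonneg (show (0 : ℝ) ≤ k + 1 by positivity)
    nlinarith
  have hd : |((k : ℝ) + 1) / (m : ℝ) - (k : ℝ) / (m : ℝ)| ≤ 1 := by
    rw [← sub_div, add_sub_cancel_left, abs_of_nonneg (by positivity)]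
    exact div_le_self zero_le_one hm0
  have hI2 := hI.trans (mul_le_of_le_one_right (by positivity) hd)
  rw [norm_mul, Real.norm_of_nonneg (by positivity : 0 ≤ Real.exp (-l) * l ^ k / (Nat.factorial k : ℝ)),
    mul_assoc _ (Real.exp (1 * (k - l)))]
  refine mul_le_mul_of_nonneg_left (hI2.trans (le_of_eq ?_)) (by positivity)
  have : Real.exp (k + 1) = Real.exp (1 * (k - l)) * Real.exp (1 + l) := by
    rw [← Real.exp_add]; congr 1; ring
  rw [this]; ring

theorem sk_wMod_nonneg (F : ℝ → ℝ) (d : ℝ) : 0 ≤ wMod F d := by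
  apply Real.sSup_nonneg
  rintro r ⟨s, t, _, _, _, rfl⟩
  positivity

theorem sk_wMod_step (F : ℝ → ℝ) (M : ℝ) (hF : ∀ t, 0 ≤ t → |F t| ≤ M * (1 + t ^ 2)) (d : ℝ)
    (s t : ℝ) (hs : 0 ≤ s) (ht : 0 ≤ t) (htd : t ≤ d) :
    |F (s + t) - F s| ≤ wMod F d * ((1 + t ^ 2) * (1 + s ^ 2)) := by
  have hM : 0 ≤ M := by
    have := (abs_nonneg _).trans (hF 0 le_rfl); simpa using this
  rcases ht.eq_or_lt with h0 | h0
  · subst h0; simp; have := sk_wMod_nonneg F d; positivity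
  rw [← div_le_iff₀ (by positivity)]
  apply le_csSup
  · refine ⟨3 * M, ?_⟩
    rintro r ⟨s, t, hs, ht, _, rfl⟩
    rw [div_le_iff₀ (by positivity)]
    have h1 := hF (s + t) (by linarith)
    have h2 := hF s hs
    have h3 := abs_sub (F (s + t)) (F s)
    have : M * (1 + (s + t) ^ 2) + M * (1 + s ^ 2) ≤ 3 * M * ((1 + t ^ 2) * (1 + s ^ 2)) := by
      rw [← sub_nonneg]
      have : 3 * M * ((1 + t ^ 2) * (1 + s ^ 2)) - (M * (1 + (s + t) ^ 2) + M * (1 + s ^ 2)) =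
        M * (1 + (s - t) ^ 2 + t ^ 2 + 3 * t ^ 2 * s ^ 2) := by ring
      rw [this]; positivity
    linarith
  · exact ⟨s, t, hs, h0, htd, rfl⟩

theorem sk_chain (F : ℝ → ℝ) (M : ℝ) (hF : ∀ t, 0 ≤ t → |F t| ≤ M * (1 + t ^ 2)) (d : ℝ)
    (hd : 0 ≤ d) (hd1 : d ≤ 1) (s : ℝ) (hs : 0 ≤ s) (n : ℕ) :
    ∀ r, 0 ≤ r → r ≤ n * d → |F (s + r) - F s| ≤ n * (2 * (1 + (s + r) ^ 2) * wMod F d) := by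
  have hW := sk_wMod_nonneg F d
  have one : ∀ s t : ℝ, 0 ≤ s → 0 ≤ t → t ≤ d →
      |F (s + t) - F s| ≤ 2 * (1 + (s + t) ^ 2) * wMod F d := by
    intro s t hs ht htd
    refine (sk_wMod_step F M hF d s t hs ht htd).trans ?_
    rw [mul_comm]
    refine mul_le_mul_of_nonneg_right ?_ hW
    refine mul_le_mul ?_ ?_ (by positivity) (by positivity)
    · nlinarith
    · nlinarith [mul_nonneg hs ht]
  induction n with
  | zero =>
    intro r h0 h1
    have : r = 0 := by simp at h1; linarith
    subst this; simp
  | succ n ih =>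
    intro r h0 h1
    push_cast at h1 ⊢
    by_cases hr : r ≤ d
    · refine (one s r hs h0 hr).trans ?_
      refine le_mul_of_one_le_left (by positivity) ?_
      linarith [(Nat.cast_nonneg n : (0 : ℝ) ≤ n)]
    · push Not at hr
      have h2 := ih (r - d) (by linarith) (by linarith)
      have h3 := one (s + (r - d)) d (by linarith) hd le_rfl
      have e : s + (r - d) + d = s + r := by ring
      rw [e] at h3
      have h4 := abs_sub_le (F (s + r)) (F (s + (r - d))) (F s)
      have h5 : (n : ℝ) * (2 * (1 + (s + (r - d)) ^ 2) * wMod F d) ≤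
          n * (2 * (1 + (s + r) ^ 2) * wMod F d) := by
        have : 0 ≤ s + (r - d) := by linarith
        gcongr
        linarith
      linarith

theorem sk_mod (F : ℝ → ℝ) (M : ℝ) (hF : ∀ t, 0 ≤ t → |F t| ≤ M * (1 + t ^ 2)) (d : ℝ)
    (hd : 0 < d) (hd1 : d ≤ 1) (x y D : ℝ) (hx : 0 ≤ x) (hy : 0 ≤ y) (hD : |y - x| ≤ D) :
    |F y - F x| ≤ (D / d + 1) * (2 * (1 + (x + D) ^ 2) * wMod F d) := by
  have hW := sk_wMod_nonneg F d
  have hD0 : 0 ≤ D := (abs_nonneg _).trans hD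
  have hn : D ≤ (⌈D / d⌉₊ : ℝ) * d := by
    rw [← div_le_iff₀ hd]; exact Nat.le_ceil _
  have hn2 : (⌈D / d⌉₊ : ℝ) ≤ D / d + 1 := (Nat.ceil_lt_add_one (by positivity)).le
  have hab := abs_le.1 hD
  rcases le_total x y with h | h
  · have h1 := sk_chain F M hF d hd.le hd1 x hx ⌈D / d⌉₊ (y - x) (by linarith) (by linarith)
    rw [add_sub_cancel] at h1
    refine h1.trans ?_
    gcongr
    linarith
  · have h1 := sk_chain F M hF d hd.le hd1 y hy ⌈D / d⌉₊ (x - y) (by linarith) (by linarith)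
    rw [add_sub_cancel, abs_sub_comm] at h1
    refine h1.trans ?_
    gcongr
    linarith

theorem sk_taylor (g : ℝ → ℝ) (hg : ContDiff ℝ 2 g) (x t K : ℝ) (hx : 0 ≤ x) (ht : 0 ≤ t)
    (hK : ∀ y, 0 ≤ y → |y - x| ≤ |t - x| → |iteratedDeriv 2 g y - iteratedDeriv 2 g x| ≤ K) :
    |g t - g x - deriv g x * (t - x) - iteratedDeriv 2 g x / 2 * (t - x) ^ 2| ≤
      K * (t - x) ^ 2 := by
  have hd1 : ∀ y, HasDerivAt g (deriv g y) y := fun y =>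
    (hg.differentiable (by norm_num) y).hasDerivAt
  have hd2 : ∀ y, HasDerivAt (deriv g) (iteratedDeriv 2 g y) y := by
    intro y
    rw [iteratedDeriv_succ, iteratedDeriv_one]
    have : ContDiff ℝ 1 (deriv g) := by
      have := (contDiff_succ_iff_deriv (n := 1) (f := g)).1 (by simpa [one_add_one_eq_two] using hg)
      exact this.2.2
    exact (this.differentiable (by norm_num) y).hasDerivAt
  have hmem : ∀ y ∈ Set.uIcc x t, 0 ≤ y ∧ |y - x| ≤ |t - x| := by
    intro y hy
    exact ⟨(le_min hx ht).trans hy.1, Set.abs_sub_left_of_mem_uIcc hy⟩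
  have hK0 : 0 ≤ K := (abs_nonneg _).trans (hK x hx (by simp))
  have h1 : ∀ y ∈ Set.uIcc x t,
      |deriv g y - deriv g x - iteratedDeriv 2 g x * (y - x)| ≤ K * |t - x| := by
    intro y hy
    have := (convex_uIcc x t).norm_image_sub_le_of_norm_hasDerivWithin_le
      (f := fun y => deriv g y - deriv g x - iteratedDeriv 2 g x * (y - x))
      (f' := fun y => iteratedDeriv 2 g y - iteratedDeriv 2 g x) (C := K)
      (fun y _ => by
        have := ((hd2 y).sub_const (deriv g x)).sub
          (((hasDerivAt_id y).sub_const x).const_mul (iteratedDeriv 2 g x))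
        refine (this.congr_deriv ?_).hasDerivWithinAt
        simp)
      (fun y hy => hK y (hmem y hy).1 (hmem y hy).2) Set.left_mem_uIcc hy
    simp only [sub_self, mul_zero, sub_zero, Real.norm_eq_abs] at this
    exact this.trans (mul_le_mul_of_nonneg_left (hmem y hy).2 hK0)
  have := (convex_uIcc x t).norm_image_sub_le_of_norm_hasDerivWithin_le
      (f := fun y => g y - g x - deriv g x * (y - x) - iteratedDeriv 2 g x / 2 * (y - x) ^ 2)
      (f' := fun y => deriv g y - deriv g x - iteratedDeriv 2 g x * (y - x)) (C := K * |t - x|)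
      (fun y _ => by
        have := (((hd1 y).sub_const (g x)).sub
          (((hasDerivAt_id y).sub_const x).const_mul (deriv g x))).sub
          ((((hasDerivAt_id y).sub_const x).pow 2).const_mul (iteratedDeriv 2 g x / 2))
        refine (this.congr_deriv ?_).hasDerivWithinAt
        simp; ring)
      (fun y hy => h1 y hy) Set.left_mem_uIcc Set.right_mem_uIcc
  simp only [sub_self, mul_zero, Real.norm_eq_abs] at this
  refine this.trans (le_of_eq ?_) |>.trans' (le_of_eq (by simp))
  rw [mul_assoc, ← abs_mul, ← sq, abs_of_nonneg (by positivity)]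

theorem sk_poly (w : ℝ) (hw : 0 ≤ w) : 2 * w ^ 2 + 3 * w ^ 4 + w ^ 6 ≤ 796 * Real.exp w := by
  have h2 := Real.pow_div_factorial_le_exp w hw 2
  have h4 := Real.pow_div_factorial_le_exp w hw 4
  have h6 := Real.pow_div_factorial_le_exp w hw 6
  norm_num [Nat.factorial] at h2 h4 h6
  linarith

theorem sk_point (x : ℝ) (g : ℝ → ℝ) (hx : 0 ≤ x) (hg : ContDiff ℝ 2 g) (M : ℝ)
    (hg2 : ∀ t : ℝ, 0 ≤ t → |iteratedDeriv 2 g t| ≤ M * (1 + t ^ 2)) (m : ℕ) (hm : 1 ≤ m)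
    (t : ℝ) (ht : 0 ≤ t) :
    |g t - g x - deriv g x * (t - x) - iteratedDeriv 2 g x / 2 * (t - x) ^ 2| ≤
      4 * (1 + x ^ 2) * 796 * wMod (iteratedDeriv 2 g) (1 / Real.sqrt (m : ℝ)) / m *
        Real.exp (Real.sqrt m * |t - x|) := by
  have hm0 : (1 : ℝ) ≤ m := by exact_mod_cast hm
  have hq : 1 ≤ Real.sqrt m := Real.one_le_sqrt.2 hm0
  have hW := sk_wMod_nonneg (iteratedDeriv 2 g) (1 / Real.sqrt (m : ℝ))
  have hT := sk_taylor g hg x t _ hx ht (fun y hy hyd =>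
    sk_mod (iteratedDeriv 2 g) M hg2 (1 / Real.sqrt m) (by positivity)
      (div_le_self zero_le_one hq) x y |t - x| hx hy hyd)
  refine hT.trans ?_
  have hsq : Real.sqrt m ^ 2 = m := Real.sq_sqrt (by positivity)
  rw [← sq_abs (t - x)]
  generalize wMod (iteratedDeriv 2 g) (1 / Real.sqrt (m : ℝ)) = W at *
  have hD : 0 ≤ |t - x| := abs_nonneg _
  generalize |t - x| = D at *
  generalize Real.sqrt (m : ℝ) = q at *
  rw [← hsq]
  have hqp : 0 < q := by linarith
  obtain ⟨w, hw⟩ : ∃ w, w = q * D := ⟨_, rfl⟩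
  have hw0 : 0 ≤ w := by rw [hw]; positivity
  have hDw : D ≤ w := by rw [hw]; nlinarith
  have hP := sk_poly w hw0
  have e1 : D / (1 / q) = w := by rw [hw]; field_simp
  have e2 : D ^ 2 = w ^ 2 / q ^ 2 := by rw [hw]; field_simp
  rw [e1, ← hw]
  have h1 : 1 + (x + D) ^ 2 ≤ 2 * (1 + x ^ 2) * (1 + w ^ 2) := by
    have : D ^ 2 ≤ w ^ 2 := by gcongr
    nlinarith [sq_nonneg (x - D), mul_nonneg (sq_nonneg x) (sq_nonneg w)]
  have h2 : w + 1 ≤ 2 + w ^ 2 := by nlinarith [sq_nonneg (w - 1)]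
  calc (w + 1) * (2 * (1 + (x + D) ^ 2) * W) * D ^ 2
      ≤ (2 + w ^ 2) * (2 * (2 * (1 + x ^ 2) * (1 + w ^ 2)) * W) * D ^ 2 := by gcongr
    _ = 4 * (1 + x ^ 2) * W / q ^ 2 * (2 * w ^ 2 + 3 * w ^ 4 + w ^ 6) := by rw [e2]; ring
    _ ≤ 4 * (1 + x ^ 2) * W / q ^ 2 * (796 * Real.exp w) := by gcongr
    _ = _ := by ring

theorem szaszKant_quantitative_voronovskaya (a : ℝ) (ha : 1 < a)
    (x : ℝ) (hx : 0 ≤ x) (g : ℝ → ℝ) (hg : ContDiff ℝ 2 g)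
    (M : ℝ) (hM : 0 < M)
    (hg0 : ∀ t : ℝ, 0 ≤ t → |g t| ≤ M * (1 + t ^ 2))
    (hg1 : ∀ t : ℝ, 0 ≤ t → |deriv g t| ≤ M * (1 + t ^ 2))
    (hg2 : ∀ t : ℝ, 0 ≤ t → |iteratedDeriv 2 g t| ≤ M * (1 + t ^ 2)) :
    ∃ C : ℝ, 0 < C ∧ ∃ m₀ : ℕ, 1 ≤ m₀ ∧ ∀ m : ℕ, m₀ ≤ m →
      (m : ℝ) *
          |szaszKant a m g x - g x - deriv g x * szaszKantCM a m 1 x -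
            iteratedDeriv 2 g x / 2 * szaszKantCM a m 2 x| ≤
        C * wMod (iteratedDeriv 2 g) (1 / Real.sqrt (m : ℝ)) := by
  obtain ⟨B, hB⟩ : ∃ B, B = 1 + x * Real.log a := ⟨_, rfl⟩
  have hL : 0 < Real.log a := Real.log_pos ha
  have hB0 : 0 ≤ B := by rw [hB]; positivity
  refine ⟨2 * (4 * (1 + x ^ 2) * 796 * Real.exp B) * Real.exp x, by positivity, 1, le_rfl, ?_⟩
  intro m hm
  have hm0 : (1 : ℝ) ≤ m := by exact_mod_cast hm
  have hmp : (0 : ℝ) < m := by linarith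
  have hW := sk_wMod_nonneg (iteratedDeriv 2 g) (1 / Real.sqrt (m : ℝ))
  have hpt := sk_point x g hx hg M hg2 m hm
  obtain ⟨hl0, hl1, hl2⟩ := sk_param a ha x hx m hm
  unfold szaszKantCM szaszKant
  generalize x * Real.log a / (a ^ ((1 : ℝ) / (m : ℝ)) - 1) = l at *
  generalize wMod (iteratedDeriv 2 g) (1 / Real.sqrt (m : ℝ)) = W at *
  have hq : 1 ≤ Real.sqrt m := Real.one_le_sqrt.2 hm0
  have hsq : Real.sqrt m ^ 2 = m := Real.sq_sqrt (by positivity)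
  have hc := hg.continuous
  -- the four series
  have s0 := (sk_summable l hl0 m hm g M hg0).hasSum.mul_left (m : ℝ)
  have s1 := (sk_summable l hl0 m hm (fun t => (t - x) ^ 1) (1 + x) (fun t ht => by
    rw [pow_one, abs_le]; constructor <;> nlinarith [mul_nonneg hx (sq_nonneg t), sq_nonneg (t - 1)])).hasSum.mul_left (m : ℝ)
  have s2 := (sk_summable l hl0 m hm (fun t => (t - x) ^ 2) (2 + 2 * x ^ 2) (fun t ht => by
    rw [abs_of_nonneg (sq_nonneg _)]
    nlinarith [mul_nonneg (sq_nonneg x) (sq_nonneg t), sq_nonneg (t + x)])).hasSum.mul_left (m : ℝ)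
  have sc := (sk_poisson_exp l 0).mul_right (g x)
  have hsum := ((s0.sub sc).sub (s1.mul_left (deriv g x))).sub
    (s2.mul_left (iteratedDeriv 2 g x / 2))
  have hone : Real.exp (l * (Real.exp 0 - 1 - 0)) * g x = g x := by simp
  rw [hone] at hsum
  rw [← hsum.tsum_eq]
  -- the dominating series
  obtain ⟨K, hK⟩ : ∃ K, K = 4 * (1 + x ^ 2) * 796 * W / m * Real.exp B := ⟨_, rfl⟩
  have hK0 : 0 ≤ K := by rw [hK]; positivity
  obtain ⟨s, hs⟩ : ∃ s, s = 1 / Real.sqrt m := ⟨_, rfl⟩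
  have hs0 : 0 ≤ s := by rw [hs]; positivity
  have hs1 : s ≤ 1 := by rw [hs]; exact div_le_self zero_le_one hq
  have hqs : Real.sqrt m = s * m := by
    rw [hs]; nth_rewrite 3 [← hsq]; field_simp
  have hls : l * s ^ 2 ≤ x := by
    have : s ^ 2 = 1 / m := by rw [hs, div_pow, hsq, one_pow]
    rw [this, mul_one_div, div_le_iff₀ hmp]; linarith
  have hdom := ((sk_poisson_exp l s).add (sk_poisson_exp l (-s))).mul_left K
  rw [← Real.norm_eq_abs]
  refine (mul_le_mul_of_nonneg_left (tsum_of_norm_bounded hdom ?_) hmp.le).trans ?_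
  · intro k
    have hk : (0 : ℝ) ≤ k := Nat.cast_nonneg k
    have hII : ∀ f : ℝ → ℝ, Continuous f → IntervalIntegrable f volume
        ((k : ℝ) / m) (((k : ℝ) + 1) / m) := fun f hf => hf.intervalIntegrable _ _
    have hint : ∫ t in ((k : ℝ) / (m : ℝ))..(((k : ℝ) + 1) / (m : ℝ)),
        (g t - g x - deriv g x * (t - x) ^ 1 - iteratedDeriv 2 g x / 2 * (t - x) ^ 2) =
        (∫ t in ((k : ℝ) / (m : ℝ))..(((k : ℝ) + 1) / (m : ℝ)), g t) - 1 / m * g x -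
        deriv g x * (∫ t in ((k : ℝ) / (m : ℝ))..(((k : ℝ) + 1) / (m : ℝ)), (t - x) ^ 1) -
        iteratedDeriv 2 g x / 2 *
          (∫ t in ((k : ℝ) / (m : ℝ))..(((k : ℝ) + 1) / (m : ℝ)), (t - x) ^ 2) := by
      rw [intervalIntegral.integral_sub (hII _ (by fun_prop)) (hII _ (by fun_prop)),
        intervalIntegral.integral_sub (hII _ (by fun_prop)) (hII _ (by fun_prop)),
        intervalIntegral.integral_sub (hII _ (by fun_prop)) (hII _ (by fun_prop)),
        intervalIntegral.integral_const_mul, intervalIntegral.integral_const_mul,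
        intervalIntegral.integral_const, ← sub_div, add_sub_cancel_left, smul_eq_mul]
    have hd : |((k : ℝ) + 1) / (m : ℝ) - (k : ℝ) / (m : ℝ)| = 1 / m := by
      rw [← sub_div, add_sub_cancel_left, abs_of_nonneg (by positivity)]
    have hI : ‖∫ t in ((k : ℝ) / (m : ℝ))..(((k : ℝ) + 1) / (m : ℝ)),
        (g t - g x - deriv g x * (t - x) ^ 1 - iteratedDeriv 2 g x / 2 * (t - x) ^ 2)‖ ≤
        K * (Real.exp (s * (k - l)) + Real.exp (-s * (k - l))) * (1 / m) := by
      rw [← hd]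
      apply intervalIntegral.norm_integral_le_of_norm_le_const
      intro t ht
      rw [Set.uIoc_of_le (by gcongr; linarith)] at ht
      have ht0 : 0 ≤ t := le_trans (by positivity) ht.1.le
      rw [pow_one, Real.norm_eq_abs]
      refine (hpt t ht0).trans ?_
      rw [hK, mul_assoc (_ / (m : ℝ))]
      refine mul_le_mul_of_nonneg_left ?_ (by positivity)
      have ha1 : (k : ℝ) < t * m := (div_lt_iff₀ hmp).1 ht.1
      have ha2 : t * m ≤ k + 1 := (le_div_iff₀ hmp).1 ht.2
      have hmt : m * |t - x| ≤ |(k : ℝ) - l| + B := by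
        rw [← abs_of_pos hmp, ← abs_mul, abs_le]
        have c1 := le_abs_self ((k : ℝ) - l)
        have c2 := neg_abs_le ((k : ℝ) - l)
        have c3 : 0 ≤ x * Real.log a := by positivity
        constructor <;> nlinarith
      have hw : Real.sqrt m * |t - x| ≤ B + |s * ((k : ℝ) - l)| := by
        rw [hqs, abs_mul, abs_of_nonneg hs0, mul_assoc]
        have := mul_le_mul_of_nonneg_left hmt hs0
        nlinarith
      refine (Real.exp_le_exp.2 hw).trans ?_
      rw [Real.exp_add]
      refine mul_le_mul_of_nonneg_left ?_ (Real.exp_pos _).le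
      rw [neg_mul]
      rcases abs_choice (s * ((k : ℝ) - l)) with h | h <;> rw [h]
      · linarith [Real.exp_pos (-(s * ((k : ℝ) - l)))]
      · linarith [Real.exp_pos (s * ((k : ℝ) - l))]
    have hp : 0 ≤ Real.exp (-l) * l ^ k / (Nat.factorial k : ℝ) := by positivity
    have key := mul_le_mul_of_nonneg_left hI (mul_nonneg hmp.le hp)
    rw [← Real.norm_of_nonneg (mul_nonneg hmp.le hp), ← norm_mul, hint,
      Real.norm_of_nonneg (mul_nonneg hmp.le hp)] at key
    refine le_trans (le_of_eq ?_) (key.trans (le_of_eq ?_))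
    · congr 1
      rw [zero_mul, Real.exp_zero]
      field_simp
    · field_simp
  · have b1 := sk_poisson_exp_le l s x hl0 (abs_le.2 ⟨by linarith, hs1⟩) hls
    have b2 := sk_poisson_exp_le l (-s) x hl0 (abs_le.2 ⟨by linarith, by linarith⟩) (by simpa using hls)
    refine (mul_le_mul_of_nonneg_left (mul_le_mul_of_nonneg_left (add_le_add b1 b2) hK0)
      hmp.le).trans (le_of_eq ?_)
    rw [hK]; field_simp; ring
end

section
/- Grüss–Voronovskaya-type theorem: Let a > 1 and fix x ≥ 0. Let μ, ν : [0,∞) → ℝ be twice continuously differentiable and suppose there is M > 0 such that each of the functions μ, μ', μ'', ν, ν', ν'' is bounded in absolute value by M(1 + t²) on [0,∞), and each of the functions μ''(t)/(1 + t²), ν''(t)/(1 + t²) and (μν)''(t)/(1 + t²)² has a finite limit as t → ∞. Then lim_{m→∞} m·( R̂_{m,a}(μ·ν; x) − R̂_{m,a}(μ; x)·R̂_{m,a}(ν; x) ) = x·μ'(x)·ν'(x). -/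
open Real MeasureTheory Filter

lemma hasSum_conv {f g : ℕ → ℝ} {s s' : ℝ} (h : HasSum f s) (h1 : ∀ k, g k = f k)
    (h2 : s' = s) : HasSum g s' := by
  have : g = f := funext h1
  rw [this, h2]; exact h

/-- Poisson weights. -/
noncomputable def poiW (l : ℝ) (k : ℕ) : ℝ := Real.exp (-l) * l ^ k / (Nat.factorial k : ℝ)

lemma poiW_nonneg {l : ℝ} (hl : 0 ≤ l) (k : ℕ) : 0 ≤ poiW l k := by
  unfold poiW; positivity

lemma poiW_hasSum (l : ℝ) : HasSum (poiW l) 1 := by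
  have h := (NormedSpace.expSeries_div_hasSum_exp (𝔸 := ℝ) l).mul_left (Real.exp (-l))
  rw [← Real.exp_eq_exp_ℝ, ← Real.exp_add, neg_add_cancel, Real.exp_zero] at h
  refine h.congr_fun ?_ |> fun h => h
  intro k
  unfold poiW
  ring

lemma poiW_stein (l : ℝ) (f : ℕ → ℝ) (s : ℝ) (h : HasSum (fun k => poiW l k * f (k + 1)) s) :
    HasSum (fun k => poiW l k * ((k : ℝ) * f k)) (l * s) := by
  rw [← hasSum_nat_add_iff' 1]
  simp only [Finset.sum_range_one, Nat.cast_zero, zero_mul, mul_zero, sub_zero]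
  refine hasSum_conv (h.mul_left l) (fun k => ?_) rfl
  unfold poiW
  rw [Nat.factorial_succ]
  have : (Nat.factorial k : ℝ) ≠ 0 := by positivity
  have : (k : ℝ) + 1 ≠ 0 := by positivity
  push_cast
  field_simp
  ring

lemma poiW_m1 (l : ℝ) : HasSum (fun k => poiW l k * (k : ℝ)) l := by
  have := poiW_stein l (fun _ => 1) 1 (by simpa using poiW_hasSum l)
  simpa using this

lemma poiW_m2 (l : ℝ) : HasSum (fun k => poiW l k * (k : ℝ) ^ 2) (l * (l + 1)) := by
  have := poiW_stein l (fun k => (k : ℝ)) (l + 1) (by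
    convert (poiW_m1 l).add (poiW_hasSum l) using 2
    push_cast; ring)
  convert this using 2
  ring

lemma poiW_m3 (l : ℝ) : HasSum (fun k => poiW l k * (k : ℝ) ^ 3)
    (l * (l * (l + 1) + 2 * l + 1)) := by
  have := poiW_stein l (fun k => (k : ℝ) ^ 2) (l * (l + 1) + 2 * l + 1) (by
    convert ((poiW_m2 l).add ((poiW_m1 l).mul_left 2)).add (poiW_hasSum l) using 2
    push_cast; ring)
  convert this using 2
  ring

lemma poiW_m4 (l : ℝ) : HasSum (fun k => poiW l k * (k : ℝ) ^ 4)
    (l * (l * (l * (l + 1) + 2 * l + 1) + 3 * (l * (l + 1)) + 3 * l + 1)) := by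
  have := poiW_stein l (fun k => (k : ℝ) ^ 3)
    (l * (l * (l + 1) + 2 * l + 1) + 3 * (l * (l + 1)) + 3 * l + 1) (by
    convert (((poiW_m3 l).add ((poiW_m2 l).mul_left 3)).add
      ((poiW_m1 l).mul_left 3)).add (poiW_hasSum l) using 2
    push_cast; ring)
  convert this using 2
  ring

lemma poiW_c4 (l : ℝ) : HasSum (fun k => poiW l k * ((k : ℝ) - l) ^ 4) (l + 3 * l ^ 2) := by
  refine hasSum_conv (((((poiW_m4 l).add ((poiW_m3 l).mul_left (-4 * l))).add
      ((poiW_m2 l).mul_left (6 * l ^ 2))).add ((poiW_m1 l).mul_left (-4 * l ^ 3))).add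
      ((poiW_hasSum l).mul_left (l ^ 4))) ?_ ?_
  · intro k; ring
  · ring

/-- The average on the `k`-th cell. -/
noncomputable def cellAvg (m : ℕ) (f : ℝ → ℝ) (k : ℕ) : ℝ :=
  (m : ℝ) * ∫ t in ((k : ℝ) / (m : ℝ))..(((k : ℝ) + 1) / (m : ℝ)), f t

/-- The Poisson parameter. -/
noncomputable def lamP (a : ℝ) (m : ℕ) (x : ℝ) : ℝ :=
  x * Real.log a / (a ^ ((1 : ℝ) / (m : ℝ)) - 1)

lemma szaszKant_eq (a : ℝ) (m : ℕ) (f : ℝ → ℝ) (x : ℝ) :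
    szaszKant a m f x = ∑' k, poiW (lamP a m x) k * cellAvg m f k := by
  unfold szaszKant cellAvg poiW lamP
  rw [← tsum_mul_left]
  congr 1
  funext k
  ring

/-- Admissible functions. -/
def Adm (f : ℝ → ℝ) : Prop := Continuous f ∧ ∃ C : ℝ, ∀ t : ℝ, 0 ≤ t → |f t| ≤ C * Real.exp t

lemma Adm.add {f g : ℝ → ℝ} (hf : Adm f) (hg : Adm g) : Adm (fun t => f t + g t) := by
  obtain ⟨hf, C, hC⟩ := hf
  obtain ⟨hg, D, hD⟩ := hg
  refine ⟨hf.add hg, C + D, fun t ht => ?_⟩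
  have := abs_add_le (f t) (g t)
  have := hC t ht
  have := hD t ht
  linarith

lemma Adm.smul {f : ℝ → ℝ} (hf : Adm f) (c : ℝ) : Adm (fun t => c * f t) := by
  obtain ⟨hf, C, hC⟩ := hf
  refine ⟨continuous_const.mul hf, |c| * C, fun t ht => ?_⟩
  rw [abs_mul, mul_assoc]
  exact mul_le_mul_of_nonneg_left (hC t ht) (abs_nonneg c)

lemma Adm.of_le {f g : ℝ → ℝ} (hg : Adm g) (hf : Continuous f)
    (h : ∀ t, 0 ≤ t → |f t| ≤ g t) : Adm f := by
  obtain ⟨_, C, hC⟩ := hg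
  exact ⟨hf, C, fun t ht => ((h t ht).trans (le_abs_self _)).trans (hC t ht)⟩

lemma adm_pow (n : ℕ) : Adm (fun t => t ^ n) := by
  refine ⟨by fun_prop, (Nat.factorial n : ℝ), fun t ht => ?_⟩
  have h := Real.pow_div_factorial_le_exp t ht n
  rw [div_le_iff₀ (by positivity)] at h
  rw [abs_of_nonneg (by positivity)]
  linarith

lemma adm_one : Adm (fun _ => 1) := by simpa using adm_pow 0

lemma adm_u (x : ℝ) : Adm (fun t => t - x) := by
  have := (adm_pow 1).add (adm_one.smul (-x))
  convert this using 2
  ring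

lemma adm_u2 (x : ℝ) : Adm (fun t => (t - x) ^ 2) := by
  have := ((adm_pow 2).add ((adm_pow 1).smul (-2 * x))).add (adm_one.smul (x ^ 2))
  convert this using 2
  ring

lemma adm_u4 (x : ℝ) : Adm (fun t => (t - x) ^ 4) := by
  have := ((((adm_pow 4).add ((adm_pow 3).smul (-4 * x))).add
    ((adm_pow 2).smul (6 * x ^ 2))).add ((adm_pow 1).smul (-4 * x ^ 3))).add (adm_one.smul (x ^ 4))
  convert this using 2
  ring

lemma cellAvg_mono {m : ℕ} (hm : 1 ≤ m) {f g : ℝ → ℝ} (hf : Continuous f) (hg : Continuous g)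
    (k : ℕ) (h : ∀ t, (k : ℝ) / m ≤ t → t ≤ ((k : ℝ) + 1) / m → f t ≤ g t) :
    cellAvg m f k ≤ cellAvg m g k := by
  unfold cellAvg
  have hm' : (0 : ℝ) < m := by exact_mod_cast hm
  refine mul_le_mul_of_nonneg_left ?_ hm'.le
  refine intervalIntegral.integral_mono_on (by gcongr; linarith) (hf.intervalIntegrable _ _)
    (hg.intervalIntegrable _ _) ?_
  intro t ht
  exact h t ht.1 ht.2

lemma cellAvg_const {m : ℕ} (hm : 1 ≤ m) (c : ℝ) (k : ℕ) : cellAvg m (fun _ => c) k = c := by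
  unfold cellAvg
  have hm' : (m : ℝ) ≠ 0 := by positivity
  simp only [intervalIntegral.integral_const, smul_eq_mul]
  field_simp
  ring

lemma cellAvg_add (m : ℕ) {f g : ℝ → ℝ} (hf : Continuous f) (hg : Continuous g) (k : ℕ) :
    cellAvg m (fun t => f t + g t) k = cellAvg m f k + cellAvg m g k := by
  unfold cellAvg
  rw [intervalIntegral.integral_add (hf.intervalIntegrable _ _) (hg.intervalIntegrable _ _)]
  ring

lemma cellAvg_smul (m : ℕ) (f : ℝ → ℝ) (c : ℝ) (k : ℕ) :
    cellAvg m (fun t => c * f t) k = c * cellAvg m f k := by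
  unfold cellAvg
  rw [intervalIntegral.integral_const_mul]
  ring

lemma cell_summable {m : ℕ} (hm : 1 ≤ m) {l : ℝ} (hl : 0 ≤ l) {f : ℝ → ℝ} (hf : Adm f) :
    Summable (fun k => poiW l k * cellAvg m f k) := by
  obtain ⟨hf, C, hC⟩ := hf
  have hm' : (1 : ℝ) ≤ m := by exact_mod_cast hm
  have hC0 : 0 ≤ C := by
    have := (abs_nonneg _).trans (hC 0 le_rfl)
    simpa using this
  have hs := (Real.summable_pow_div_factorial (l * Real.exp 1)).mul_left
    (Real.exp (-l) * (C * Real.exp 1))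
  refine Summable.of_norm_bounded hs (fun k => ?_)
  have key : ∀ t, (k : ℝ) / m ≤ t → t ≤ ((k : ℝ) + 1) / m →
      |f t| ≤ C * Real.exp ((k : ℝ) + 1) := by
    intro t h1 h2
    refine (hC t (le_trans (by positivity) h1)).trans ?_
    refine mul_le_mul_of_nonneg_left (Real.exp_le_exp.2 (h2.trans ?_)) hC0
    exact div_le_self (by positivity) hm'
  have h1 : |cellAvg m f k| ≤ C * Real.exp ((k : ℝ) + 1) := by
    rw [abs_le]
    constructor
    · rw [← cellAvg_const hm (-(C * Real.exp ((k : ℝ) + 1))) k]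
      exact cellAvg_mono hm continuous_const hf k fun t a b => (abs_le.1 (key t a b)).1
    · rw [← cellAvg_const hm ((C * Real.exp ((k : ℝ) + 1))) k]
      exact cellAvg_mono hm hf continuous_const k fun t a b => (abs_le.1 (key t a b)).2
  rw [Real.norm_eq_abs, abs_mul, abs_of_nonneg (poiW_nonneg hl k)]
  refine (mul_le_mul_of_nonneg_left h1 (poiW_nonneg hl k)).trans (le_of_eq ?_)
  unfold poiW
  rw [Real.exp_add, mul_pow, ← Real.exp_nat_mul, mul_one]
  ring

lemma lamP_bounds {a : ℝ} (ha : 1 < a) {m : ℕ} (hm : 1 ≤ m) {x : ℝ} (hx : 0 ≤ x) :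
    0 ≤ lamP a m x ∧ 0 ≤ x - lamP a m x / m ∧ x - lamP a m x / m ≤ x * Real.log a / m := by
  have hm' : (0 : ℝ) < m := by exact_mod_cast hm
  have hlog : 0 < Real.log a := Real.log_pos ha
  set h := Real.log a / m with hh
  have hpos : 0 < h := by positivity
  have hrw : a ^ ((1 : ℝ) / (m : ℝ)) = Real.exp h := by
    rw [Real.rpow_def_of_pos (by linarith), hh]; congr 1; ring
  have hlm : lamP a m x / m = x * (h / (Real.exp h - 1)) := by
    unfold lamP; rw [hrw, hh]; ring
  have he : h < Real.exp h - 1 := by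
    have := Real.add_one_lt_exp hpos.ne'
    linarith
  have he2 : (1 - h) * Real.exp h ≤ 1 := by
    have h1 := Real.add_one_le_exp (-h)
    have h2 : Real.exp (-h) * Real.exp h = 1 := by rw [← Real.exp_add]; simp
    nlinarith [Real.exp_pos h]
  have q1 : h / (Real.exp h - 1) ≤ 1 := by rw [div_le_one (by linarith)]; exact he.le
  have q2 : 1 - h ≤ h / (Real.exp h - 1) := by
    rw [le_div_iff₀ (by linarith)]; nlinarith
  refine ⟨?_, ?_, ?_⟩
  · unfold lamP; rw [hrw]
    apply div_nonneg (by positivity); linarith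
  · rw [hlm]; nlinarith
  · rw [hlm, mul_div_assoc, ← hh]; nlinarith

section ops
variable {a : ℝ} (ha : 1 < a) {m : ℕ} (hm : 1 ≤ m) {x : ℝ} (hx : 0 ≤ x)

lemma sK_hasSum (ha : 1 < a) (hm : 1 ≤ m) (hx : 0 ≤ x) {f : ℝ → ℝ} (hf : Adm f) :
    HasSum (fun k => poiW (lamP a m x) k * cellAvg m f k) (szaszKant a m f x) := by
  rw [szaszKant_eq]
  exact (cell_summable hm (lamP_bounds ha hm hx).1 hf).hasSum

lemma sK_add (ha : 1 < a) (hm : 1 ≤ m) (hx : 0 ≤ x) {f g : ℝ → ℝ} (hf : Adm f) (hg : Adm g) :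
    szaszKant a m (fun t => f t + g t) x = szaszKant a m f x + szaszKant a m g x := by
  refine (sK_hasSum ha hm hx (hf.add hg)).unique ?_
  convert (sK_hasSum ha hm hx hf).add (sK_hasSum ha hm hx hg) using 2 with k
  rw [cellAvg_add m hf.1 hg.1]; ring

lemma sK_smul (a : ℝ) (m : ℕ) (x : ℝ) (f : ℝ → ℝ) (c : ℝ) :
    szaszKant a m (fun t => c * f t) x = c * szaszKant a m f x := by
  rw [szaszKant_eq, szaszKant_eq, ← tsum_mul_left]
  congr 1
  funext k
  rw [cellAvg_smul]; ring

lemma sK_one (ha : 1 < a) (hm : 1 ≤ m) (hx : 0 ≤ x) : szaszKant a m (fun _ => 1) x = 1 := by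
  refine (sK_hasSum ha hm hx adm_one).unique ?_
  simpa [cellAvg_const hm] using poiW_hasSum (lamP a m x)

lemma sK_mono (ha : 1 < a) (hm : 1 ≤ m) (hx : 0 ≤ x) {f g : ℝ → ℝ} (hf : Adm f) (hg : Adm g)
    (h : ∀ t, 0 ≤ t → f t ≤ g t) : szaszKant a m f x ≤ szaszKant a m g x := by
  refine hasSum_le (fun k => ?_) (sK_hasSum ha hm hx hf) (sK_hasSum ha hm hx hg)
  refine mul_le_mul_of_nonneg_left ?_ (poiW_nonneg (lamP_bounds ha hm hx).1 k)
  refine cellAvg_mono hm hf.1 hg.1 k fun t h1 _ => h t (le_trans (by positivity) h1)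

lemma sK_abs (ha : 1 < a) (hm : 1 ≤ m) (hx : 0 ≤ x) {f g : ℝ → ℝ} (hf : Adm f) (hg : Adm g)
    (h : ∀ t, 0 ≤ t → |f t| ≤ g t) : |szaszKant a m f x| ≤ szaszKant a m g x := by
  rw [abs_le]
  constructor
  · have := sK_mono ha hm hx (hg.smul (-1)) hf (fun t ht => by
      have := (abs_le.1 (h t ht)).1; linarith)
    rw [sK_smul] at this
    linarith
  · exact sK_mono ha hm hx hf hg fun t ht => (abs_le.1 (h t ht)).2

lemma sK_D1 (ha : 1 < a) (hm : 1 ≤ m) (hx : 0 ≤ x) :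
    szaszKant a m (fun t => t - x) x = -(x - lamP a m x / m) + 1 / (2 * m) := by
  have hm' : (m : ℝ) ≠ 0 := by positivity
  refine (sK_hasSum ha hm hx (adm_u x)).unique ?_
  refine hasSum_conv (((poiW_m1 (lamP a m x)).mul_left (1 / (m : ℝ))).add
    ((poiW_hasSum (lamP a m x)).mul_left (1 / (2 * m) - x))) ?_ ?_
  · intro k
    have : cellAvg m (fun t => t - x) k = k / m + 1 / (2 * m) - x := by
      unfold cellAvg
      rw [intervalIntegral.integral_sub (by simp) (by simp)]
      simp only [integral_id, intervalIntegral.integral_const, smul_eq_mul]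
      field_simp
      ring
    rw [this]; ring
  · ring

lemma sK_D2 (ha : 1 < a) (hm : 1 ≤ m) (hx : 0 ≤ x) :
    szaszKant a m (fun t => (t - x) ^ 2) x =
      lamP a m x / m ^ 2 + (x - lamP a m x / m) ^ 2 - (x - lamP a m x / m) / m
        + 1 / (3 * m ^ 2) := by
  have hm' : (m : ℝ) ≠ 0 := by positivity
  refine (sK_hasSum ha hm hx (adm_u2 x)).unique ?_
  refine hasSum_conv ((((poiW_m2 (lamP a m x)).mul_left (1 / (m : ℝ) ^ 2)).add
    ((poiW_m1 (lamP a m x)).mul_left (1 / (m : ℝ) ^ 2 - 2 * x / m))).add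
    ((poiW_hasSum (lamP a m x)).mul_left (x ^ 2 - x / m + 1 / (3 * m ^ 2)))) ?_ ?_
  · intro k
    have : cellAvg m (fun t => (t - x) ^ 2) k
        = (k / m - x) ^ 2 + (k / m - x) / m + 1 / (3 * m ^ 2) := by
      unfold cellAvg
      rw [intervalIntegral.integral_comp_sub_right (fun t => t ^ 2) x, integral_pow]
      have e : ((k : ℝ) + 1) / m - x = (k / m - x) + 1 / m := by ring
      have e2 : 1 / (3 * (m : ℝ) ^ 2) = (1 / m) ^ 2 / 3 := by ring
      have e3 : ((k : ℝ) / m - x) / m = (k / m - x) * (1 / m) := by ring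
      have e4 : (m : ℝ) * (1 / m) = 1 := by field_simp
      rw [e, e2, e3]
      generalize (k : ℝ) / m - x = c
      generalize 1 / (m : ℝ) = v at *
      push_cast
      linear_combination (c ^ 2 + c * v + v ^ 2 / 3) * e4
    rw [this]; ring
  · ring

lemma sK_D4 (ha : 1 < a) (hm : 1 ≤ m) (hx : 0 ≤ x) :
    szaszKant a m (fun t => (t - x) ^ 4) x ≤
      27 * ((lamP a m x + 3 * lamP a m x ^ 2) / m ^ 4 + 1 / m ^ 4
        + (x - lamP a m x / m) ^ 4) := by
  have hm' : (0 : ℝ) < m := by positivity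
  have hb := lamP_bounds ha hm hx
  set l := lamP a m x with hl
  have hs : HasSum (fun k => poiW l k *
      (27 * (((k : ℝ) - l) ^ 4 / m ^ 4 + 1 / m ^ 4 + (x - l / m) ^ 4)))
      (27 * ((l + 3 * l ^ 2) / m ^ 4 + 1 / m ^ 4 + (x - l / m) ^ 4)) := by
    refine hasSum_conv (((poiW_c4 l).mul_left (27 / (m : ℝ) ^ 4)).add
      ((poiW_hasSum l).mul_left (27 * (1 / m ^ 4 + (x - l / m) ^ 4)))) ?_ ?_
    · intro k; ring
    · ring
  refine hasSum_le (fun k => ?_) (sK_hasSum ha hm hx (adm_u4 x)) hs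
  refine mul_le_mul_of_nonneg_left ?_ (poiW_nonneg hb.1 k)
  rw [← cellAvg_const hm (27 * (((k : ℝ) - l) ^ 4 / m ^ 4 + 1 / m ^ 4 + (x - l / m) ^ 4)) k]
  refine cellAvg_mono hm (adm_u4 x).1 continuous_const k fun t h1 h2 => ?_
  have e1 : ((k : ℝ) - l) ^ 4 / m ^ 4 = (((k : ℝ) - l) / m) ^ 4 := by rw [div_pow]
  set v := t - k / m with hv
  have hv0 : 0 ≤ v := by linarith
  have hv1 : v ≤ 1 / m := by rw [add_div] at h2; linarith
  have e2 : v ^ 4 ≤ 1 / m ^ 4 := by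
    calc v ^ 4 ≤ (1 / (m : ℝ)) ^ 4 := by gcongr
      _ = _ := by rw [div_pow, one_pow]
  have e3 : t - x = ((k : ℝ) - l) / m + v - (x - l / m) := by
    rw [hv]; ring
  have gen : ∀ p q r : ℝ, (p + q - r) ^ 4 ≤ 27 * (p ^ 4 + q ^ 4 + r ^ 4) := by
    intro p q r
    have h3 : (p + q - r) ^ 2 ≤ 3 * (p ^ 2 + q ^ 2 + r ^ 2) := by
      nlinarith [sq_nonneg (p - q), sq_nonneg (p + r), sq_nonneg (q + r)]
    have h4 : (p ^ 2 + q ^ 2 + r ^ 2) ^ 2 ≤ 3 * (p ^ 4 + q ^ 4 + r ^ 4) := by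
      nlinarith [sq_nonneg (p ^ 2 - q ^ 2), sq_nonneg (p ^ 2 - r ^ 2), sq_nonneg (q ^ 2 - r ^ 2)]
    have h5 : ((p + q - r) ^ 2) ^ 2 ≤ (3 * (p ^ 2 + q ^ 2 + r ^ 2)) ^ 2 := by gcongr
    nlinarith
  rw [e1, e3]
  have := gen (((k : ℝ) - l) / m) v (x - l / m)
  linarith

end ops

lemma taylor_quad (μ : ℝ → ℝ) (hμ : ContDiff ℝ 2 μ) (M : ℝ) (x : ℝ)
    (hμ0 : ∀ t : ℝ, 0 ≤ t → |μ t| ≤ M * (1 + t ^ 2)) :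
    ∃ C : ℝ, 0 ≤ C ∧ ∀ t, 0 ≤ t → |μ t - μ x - deriv μ x * (t - x)| ≤ C * (t - x) ^ 2 := by
  have hd1 : ContDiff ℝ 1 (deriv μ) := by
    have : ContDiff ℝ (1 + 1) μ := by simpa [one_add_one_eq_two] using hμ
    exact (contDiff_succ_iff_deriv.1 this).2.2
  have hd : Differentiable ℝ μ := hμ.differentiable (by norm_num)
  have hd' : Differentiable ℝ (deriv μ) := hd1.differentiable (by norm_num)
  have hc : Continuous (deriv (deriv μ)) := hd1.continuous_deriv le_rfl
  obtain ⟨B, hB⟩ := (isCompact_Icc (a := x - 1) (b := x + 1)).exists_bound_of_continuousOn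
    hc.continuousOn
  have hB0 : 0 ≤ B := (norm_nonneg _).trans (hB x ⟨by linarith, by linarith⟩)
  have hnear : ∀ t, |t - x| ≤ 1 → |μ t - μ x - deriv μ x * (t - x)| ≤ B * (t - x) ^ 2 := by
    intro t ht
    have hxm : x ∈ Set.Icc (x - |t - x|) (x + |t - x|) :=
      ⟨by linarith [abs_nonneg (t - x)], by linarith [abs_nonneg (t - x)]⟩
    have htm : t ∈ Set.Icc (x - |t - x|) (x + |t - x|) :=
      ⟨by linarith [neg_abs_le (t - x)], by linarith [le_abs_self (t - x)]⟩
    have h1 : ∀ s ∈ Set.Icc (x - |t - x|) (x + |t - x|),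
        ‖deriv μ s - deriv μ x‖ ≤ B * |t - x| := by
      intro s hs
      have := (convex_Icc (x - |t - x|) (x + |t - x|)).norm_image_sub_le_of_norm_deriv_le
        (f := deriv μ) (C := B) (fun y _ => hd' y)
        (fun y hy => hB y ⟨by linarith [hy.1], by linarith [hy.2]⟩) hxm hs
      refine this.trans (mul_le_mul_of_nonneg_left ?_ hB0)
      rw [Real.norm_eq_abs, abs_le]
      constructor <;> linarith [hs.1, hs.2]
    have hder : ∀ s, HasDerivAt (fun s => μ s - deriv μ x * s) (deriv μ s - deriv μ x) s := by
      intro s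
      have := (hd s).hasDerivAt.sub ((hasDerivAt_id s).const_mul (deriv μ x))
      rw [mul_one] at this
      exact this
    have h2 := (convex_Icc (x - |t - x|) (x + |t - x|)).norm_image_sub_le_of_norm_hasDerivWithin_le
        (f := fun s => μ s - deriv μ x * s) (C := B * |t - x|)
        (fun y _ => (hder y).hasDerivWithinAt) h1 hxm htm
    rw [Real.norm_eq_abs, Real.norm_eq_abs, mul_assoc, abs_mul_abs_self] at h2
    calc _ = |μ t - deriv μ x * t - (μ x - deriv μ x * x)| := by congr 1; ring
      _ ≤ _ := h2
      _ = _ := by ring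
  have hM0 : 0 ≤ M := by simpa using (abs_nonneg _).trans (hμ0 0 le_rfl)
  refine ⟨B + (M * (1 + 2 * x ^ 2 + 2) + |μ x| + |deriv μ x|), by positivity, fun t ht => ?_⟩
  rcases le_total |t - x| 1 with h | h
  · refine (hnear t h).trans ?_
    gcongr
    have : 0 ≤ M * (1 + 2 * x ^ 2 + 2) + |μ x| + |deriv μ x| := by positivity
    linarith
  · have hu : 1 ≤ (t - x) ^ 2 := by rw [← sq_abs]; nlinarith
    have hu1 : |t - x| ≤ (t - x) ^ 2 := by rw [← sq_abs]; nlinarith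
    have e1 : |μ t - μ x - deriv μ x * (t - x)| ≤ |μ t| + |μ x| + |deriv μ x| * |t - x| := by
      rw [← abs_mul]
      exact (abs_sub _ _).trans (by gcongr; exact abs_sub _ _)
    have e2 := hμ0 t ht
    have e3 : 1 + t ^ 2 ≤ (1 + 2 * x ^ 2 + 2) * (t - x) ^ 2 := by
      nlinarith [sq_nonneg (t - 2 * x), sq_nonneg x, mul_nonneg (sq_nonneg x) (sub_nonneg.2 hu)]
    have e4 := mul_le_mul_of_nonneg_left e3 hM0
    have e5 := mul_le_mul_of_nonneg_left hu1 (abs_nonneg (deriv μ x))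
    have e6 := mul_le_mul_of_nonneg_left hu (abs_nonneg (μ x))
    have e7 := mul_nonneg hB0 (sq_nonneg (t - x))
    nlinarith

lemma moment_bounds {a : ℝ} (ha : 1 < a) {m : ℕ} (hm : 1 ≤ m) {x : ℝ} (hx : 0 ≤ x) :
    |szaszKant a m (fun t => t - x) x| ≤ (x * Real.log a + 1) / m ∧
    |m * szaszKant a m (fun t => (t - x) ^ 2) x - x| ≤
      (2 * (x * Real.log a) + (x * Real.log a) ^ 2 + 1) / m ∧
    szaszKant a m (fun t => (t - x) ^ 4) x ≤
      27 * (x + 3 * x ^ 2 + 1 + (x * Real.log a) ^ 4) / m ^ 2 := by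
  have hm1 : (1 : ℝ) ≤ m := by exact_mod_cast hm
  have hm' : (0 : ℝ) < m := by linarith
  obtain ⟨hl, hd0, hd1⟩ := lamP_bounds ha hm hx
  have h4 := sK_D4 ha hm hx
  rw [sK_D1 ha hm hx, sK_D2 ha hm hx]
  have hlog : 0 < Real.log a := Real.log_pos ha
  set b := x * Real.log a with hb
  have hb0 : 0 ≤ b := by positivity
  obtain ⟨d, hd⟩ : ∃ d, d = x - lamP a m x / m := ⟨_, rfl⟩
  have hlam : lamP a m x = m * (x - d) := by rw [hd]; field_simp; ring
  rw [← hd] at hd0 hd1 h4 ⊢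
  rw [hlam] at h4 hl ⊢
  have hxd : 0 ≤ x - d := by
    by_contra hcon
    push Not at hcon
    nlinarith
  obtain ⟨e, he⟩ : ∃ e : ℝ, e = 1 / m := ⟨_, rfl⟩
  have he0 : 0 < e := by rw [he]; positivity
  have he1 : e ≤ 1 := by rw [he, div_le_one hm']; exact hm1
  have hme : m * e = 1 := by rw [he]; field_simp
  have hdb : d ≤ b * e := by rw [he]; linarith [hd1, mul_one_div b (m : ℝ)]
  refine ⟨?_, ?_, ?_⟩
  · have r1 : (b + 1) / m = (b + 1) * e := by rw [he]; ring
    have r2 : 1 / (2 * (m : ℝ)) = e / 2 := by rw [he]; ring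
    rw [r1, r2, abs_le]
    constructor <;> nlinarith
  · have r1 : m * (m * (x - d) / m ^ 2 + d ^ 2 - d / m + 1 / (3 * m ^ 2)) - x
      = -2 * d + m * d ^ 2 + e / 3 := by rw [he]; field_simp; ring
    have r2 : (2 * b + b ^ 2 + 1) / m = 2 * (b * e) + b ^ 2 * e + e := by rw [he]; ring
    have r3 : m * d ^ 2 ≤ b ^ 2 * e := by
      calc m * d ^ 2 ≤ m * (b * e) ^ 2 := by gcongr
        _ = b ^ 2 * e * (m * e) := by ring
        _ = _ := by rw [hme, mul_one]
    have r4 : 0 ≤ m * d ^ 2 := by positivity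
    have r5 : 0 ≤ b ^ 2 * e := by positivity
    have r6 : 0 ≤ b * e := by positivity
    rw [r1, r2, abs_le]
    constructor <;> linarith
  · refine h4.trans ?_
    have r1 : (m * (x - d) + 3 * (m * (x - d)) ^ 2) / (m : ℝ) ^ 4 + 1 / (m : ℝ) ^ 4
       = (x - d) * e ^ 3 + 3 * (x - d) ^ 2 * e ^ 2 + e ^ 4 := by
      rw [he]; field_simp
    have r2 : 27 * (x + 3 * x ^ 2 + 1 + b ^ 4) / (m : ℝ) ^ 2
      = 27 * (x * e ^ 2 + 3 * x ^ 2 * e ^ 2 + e ^ 2 + b ^ 4 * e ^ 2) := by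
      rw [he]; field_simp
    rw [r1, r2]
    have p3 : e ^ 3 ≤ e ^ 2 := pow_le_pow_of_le_one he0.le he1 (by norm_num)
    have p4 : e ^ 4 ≤ e ^ 2 := pow_le_pow_of_le_one he0.le he1 (by norm_num)
    have hxd' : x - d ≤ x := by linarith
    have q1 : (x - d) * e ^ 3 ≤ x * e ^ 2 := by gcongr
    have q2 : 3 * (x - d) ^ 2 * e ^ 2 ≤ 3 * x ^ 2 * e ^ 2 := by gcongr
    have q3 : d ^ 4 ≤ b ^ 4 * e ^ 2 := by
      calc d ^ 4 ≤ (b * e) ^ 4 := by gcongr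
        _ = b ^ 4 * e ^ 4 := by ring
        _ ≤ _ := by gcongr
    linarith

set_option maxHeartbeats 2000000

theorem szaszKant_gruss_voronovskaya (a : ℝ) (ha : 1 < a)
    (x : ℝ) (hx : 0 ≤ x) (μ ν : ℝ → ℝ)
    (hμ : ContDiff ℝ 2 μ) (hν : ContDiff ℝ 2 ν) (M : ℝ) (hM : 0 < M)
    (hμ0 : ∀ t : ℝ, 0 ≤ t → |μ t| ≤ M * (1 + t ^ 2))
    (hμ1 : ∀ t : ℝ, 0 ≤ t → |deriv μ t| ≤ M * (1 + t ^ 2))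
    (hμ2 : ∀ t : ℝ, 0 ≤ t → |iteratedDeriv 2 μ t| ≤ M * (1 + t ^ 2))
    (hν0 : ∀ t : ℝ, 0 ≤ t → |ν t| ≤ M * (1 + t ^ 2))
    (hν1 : ∀ t : ℝ, 0 ≤ t → |deriv ν t| ≤ M * (1 + t ^ 2))
    (hν2 : ∀ t : ℝ, 0 ≤ t → |iteratedDeriv 2 ν t| ≤ M * (1 + t ^ 2))
    (hμlim : ∃ L : ℝ, Tendsto (fun t => iteratedDeriv 2 μ t / (1 + t ^ 2)) atTop (nhds L))
    (hνlim : ∃ L : ℝ, Tendsto (fun t => iteratedDeriv 2 ν t / (1 + t ^ 2)) atTop (nhds L))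
    (hμνlim : ∃ L : ℝ, Tendsto
      (fun t => iteratedDeriv 2 (fun s => μ s * ν s) t / (1 + t ^ 2) ^ 2) atTop (nhds L)) :
    Tendsto (fun m : ℕ => (m : ℝ) *
        (szaszKant a m (fun t => μ t * ν t) x - szaszKant a m μ x * szaszKant a m ν x))
      atTop (nhds (x * deriv μ x * deriv ν x)) := by
  obtain ⟨C₁, hC₁, hr⟩ := taylor_quad μ hμ M x hμ0
  obtain ⟨C₂, hC₂, hs⟩ := taylor_quad ν hν M x hν0
  set α := deriv μ x with hα
  set β := deriv ν x with hβ
  obtain ⟨r, hrdef⟩ : ∃ r : ℝ → ℝ, r = fun t => μ t - μ x - α * (t - x) := ⟨_, rfl⟩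
  obtain ⟨s, hsdef⟩ : ∃ s : ℝ → ℝ, s = fun t => ν t - ν x - β * (t - x) := ⟨_, rfl⟩
  have hr' : ∀ t, 0 ≤ t → |r t| ≤ C₁ * (t - x) ^ 2 := by rw [hrdef]; exact hr
  have hs' : ∀ t, 0 ≤ t → |s t| ≤ C₂ * (t - x) ^ 2 := by rw [hsdef]; exact hs
  have hμc := hμ.continuous
  have hνc := hν.continuous
  have hrc : Continuous r := by rw [hrdef]; fun_prop
  have hsc : Continuous s := by rw [hsdef]; fun_prop
  have ar : Adm r := ((adm_u2 x).smul C₁).of_le hrc hr'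
  have as : Adm s := ((adm_u2 x).smul C₂).of_le hsc hs'
  obtain ⟨q, hqdef⟩ : ∃ q : ℝ → ℝ, q = fun t =>
    α * (t - x) * s t + β * (t - x) * r t + r t * s t := ⟨_, rfl⟩
  have hqc : Continuous q := by rw [hqdef]; fun_prop
  set G := |α| * C₂ + |β| * C₁ + C₁ * C₂ with hG
  have hG0 : 0 ≤ G := by positivity
  have hq : ∀ w : ℝ, 0 < w → ∀ t, 0 ≤ t →
      |q t| ≤ G / w * (t - x) ^ 2 + (G * w + G) * (t - x) ^ 4 := by
    intro w hw t ht
    have h1 := hr' t ht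
    have h2 := hs' t ht
    set u := t - x
    have h3 : |q t| ≤ |α| * |u| * |s t| + |β| * |u| * |r t| + |r t| * |s t| := by
      rw [hqdef, ← abs_mul, ← abs_mul, ← abs_mul, ← abs_mul, ← abs_mul]
      exact (abs_add_le _ _).trans (by gcongr; exact abs_add_le _ _)
    have h4 : |q t| ≤ |α| * |u| * (C₂ * u ^ 2) + |β| * |u| * (C₁ * u ^ 2)
        + C₁ * u ^ 2 * (C₂ * u ^ 2) := by
      refine h3.trans ?_
      gcongr
    have h5 : |u| * u ^ 2 ≤ 1 / w * u ^ 2 + w * u ^ 4 := by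
      have e1 : u ^ 4 = |u| ^ 2 * u ^ 2 := by rw [sq_abs]; ring
      rw [e1, ← mul_assoc, ← add_mul]
      refine mul_le_mul_of_nonneg_right ?_ (sq_nonneg u)
      have e2 : 0 ≤ 1 / w * (1 - w * |u|) ^ 2 := by positivity
      have e3 : 1 / w * (1 - w * |u|) ^ 2 = 1 / w - 2 * |u| + w * |u| ^ 2 := by field_simp; ring
      linarith [abs_nonneg u]
    have h6 : |α| * |u| * (C₂ * u ^ 2) + |β| * |u| * (C₁ * u ^ 2)
        + C₁ * u ^ 2 * (C₂ * u ^ 2)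
        ≤ G * (|u| * u ^ 2) + G * u ^ 4 := by
      have e1 : 0 ≤ C₁ * C₂ * (|u| * u ^ 2) := by positivity
      have e2 : 0 ≤ (|α| * C₂ + |β| * C₁) * u ^ 4 := by positivity
      rw [hG]; linarith
    have h7 := mul_le_mul_of_nonneg_left h5 hG0
    calc |q t| ≤ G * (1 / w * u ^ 2 + w * u ^ 4) + G * u ^ 4 := by linarith
      _ = _ := by ring
  have aq : Adm q := (((adm_u2 x).smul (G / 1)).add ((adm_u4 x).smul (G * 1 + G))).of_le hqc
    (hq 1 one_pos)
  have hμe : μ = fun t => μ x * 1 + (α * (t - x) + r t) := by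
    rw [hrdef]; funext t; ring
  have hνe : ν = fun t => ν x * 1 + (β * (t - x) + s t) := by
    rw [hsdef]; funext t; ring
  have hμνe : (fun t => μ t * ν t) = fun t => (μ x * ν x) * 1 + ((μ x * β + ν x * α) * (t - x) +
      (α * β * (t - x) ^ 2 + (μ x * s t + (ν x * r t + q t)))) := by
    funext t
    rw [hqdef, hrdef, hsdef]; ring
  have hlog : 0 < Real.log a := Real.log_pos ha
  obtain ⟨b, hb⟩ : ∃ b, b = x * Real.log a := ⟨_, rfl⟩
  have hb0 : 0 ≤ b := by rw [hb]; positivity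
  set K₁ := b + 1 with hK₁
  set K₂ := 2 * b + b ^ 2 + 1 with hK₂
  set K₄ := 27 * (x + 3 * x ^ 2 + 1 + b ^ 4) with hK₄
  have hK₁0 : 0 ≤ K₁ := by positivity
  have hK₂0 : 0 ≤ K₂ := by positivity
  have hK₄0 : 0 ≤ K₄ := by positivity
  set E₁ := |α| * K₁ + C₁ * (x + K₂) with hE₁
  set E₂ := |β| * K₁ + C₂ * (x + K₂) with hE₂
  set K := |α * β| * K₂ + (G * (x + K₂) + 2 * G * K₄) + E₁ * E₂ with hK
  have main : ∀ m : ℕ, 1 ≤ m → |(m : ℝ) *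
        (szaszKant a m (fun t => μ t * ν t) x - szaszKant a m μ x * szaszKant a m ν x)
        - x * α * β| ≤ K * (1 / Real.sqrt m) := by
    intro m hm
    have hm1 : (1 : ℝ) ≤ m := by exact_mod_cast hm
    have hm' : (0 : ℝ) < m := by linarith
    obtain ⟨w, hw⟩ : ∃ w, w = Real.sqrt m := ⟨_, rfl⟩
    rw [← hw]
    have hw1 : 1 ≤ w := by rw [hw]; exact Real.one_le_sqrt.2 hm1
    have hw0 : 0 < w := by linarith
    have hwm : (m : ℝ) = w ^ 2 := by rw [hw, Real.sq_sqrt hm'.le]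
    obtain ⟨m1, m2, m4⟩ := moment_bounds ha hm hx
    have lμ : szaszKant a m μ x = μ x + (α * szaszKant a m (fun t => t - x) x
        + szaszKant a m r x) := by
      conv_lhs => rw [hμe]
      rw [sK_add ha hm hx (adm_one.smul _) (((adm_u x).smul α).add ar),
        sK_add ha hm hx ((adm_u x).smul α) ar, sK_smul, sK_smul, sK_one ha hm hx, mul_one]
    have lν : szaszKant a m ν x = ν x + (β * szaszKant a m (fun t => t - x) x
        + szaszKant a m s x) := by
      conv_lhs => rw [hνe]
      rw [sK_add ha hm hx (adm_one.smul _) (((adm_u x).smul β).add as),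
        sK_add ha hm hx ((adm_u x).smul β) as, sK_smul, sK_smul, sK_one ha hm hx, mul_one]
    have A1 := (ar.smul (ν x)).add aq
    have A2 := (as.smul (μ x)).add A1
    have A3 := ((adm_u2 x).smul (α * β)).add A2
    have A4 := ((adm_u x).smul (μ x * β + ν x * α)).add A3
    have lμν : szaszKant a m (fun t => μ t * ν t) x = μ x * ν x +
        ((μ x * β + ν x * α) * szaszKant a m (fun t => t - x) x +
        (α * β * szaszKant a m (fun t => (t - x) ^ 2) x + (μ x * szaszKant a m s x +
        (ν x * szaszKant a m r x + szaszKant a m q x)))) := by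
      conv_lhs => rw [hμνe]
      rw [sK_add ha hm hx (adm_one.smul _) A4,
        sK_add ha hm hx ((adm_u x).smul _) A3,
        sK_add ha hm hx ((adm_u2 x).smul _) A2,
        sK_add ha hm hx (as.smul _) A1,
        sK_add ha hm hx (ar.smul _) aq,
        sK_smul, sK_smul, sK_smul, sK_smul, sK_smul, sK_one ha hm hx, mul_one]
    have bR := sK_abs ha hm hx ar ((adm_u2 x).smul C₁) hr'
    have bS := sK_abs ha hm hx as ((adm_u2 x).smul C₂) hs'
    have bQ := sK_abs ha hm hx aq (((adm_u2 x).smul (G / w)).add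
      ((adm_u4 x).smul (G * w + G))) (hq w hw0)
    rw [sK_add ha hm hx ((adm_u2 x).smul _) ((adm_u4 x).smul _), sK_smul, sK_smul] at bQ
    rw [sK_smul] at bR bS
    rw [lμ, lν, lμν]
    rw [← hb] at m1 m2 m4
    rw [← hK₁] at m1
    rw [← hK₂] at m2
    rw [← hK₄] at m4
    generalize szaszKant a m (fun t => t - x) x = D1 at *
    generalize szaszKant a m (fun t => (t - x) ^ 2) x = D2 at *
    generalize szaszKant a m (fun t => (t - x) ^ 4) x = D4 at *
    generalize szaszKant a m r x = R at *
    generalize szaszKant a m s x = S at *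
    generalize szaszKant a m q x = Q at *
    rw [hwm] at *
    clear lμ lν lμν
    obtain ⟨e, he⟩ : ∃ e, e = 1 / w := ⟨_, rfl⟩
    have he0 : 0 < e := by rw [he]; positivity
    have hew : w * e = 1 := by rw [he]; field_simp
    have he1 : e ≤ 1 := by rw [he, div_le_one hw0]; exact hw1
    rw [← he]
    have m1' : |D1| ≤ K₁ * e ^ 2 := by rw [he]; refine m1.trans (le_of_eq ?_); field_simp
    have m2' : |w ^ 2 * D2 - x| ≤ K₂ * e ^ 2 := by
      rw [he]; refine m2.trans (le_of_eq ?_); field_simp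
    have m4' : D4 ≤ K₄ * e ^ 4 := by rw [he]; refine m4.trans (le_of_eq ?_); field_simp
    have hwe2 : w ^ 2 * e ^ 2 = 1 := by rw [← mul_pow, hew, one_pow]
    have pe2 : e ^ 2 ≤ e := by nlinarith
    have pe2' : e ^ 2 ≤ 1 := by nlinarith
    have c2 : w ^ 2 * D2 ≤ x + K₂ := by
      have := (abs_le.1 m2').2
      nlinarith
    have c2' : D2 ≤ (x + K₂) * e ^ 2 := by
      calc D2 = (w ^ 2 * e ^ 2) * D2 := by rw [hwe2, one_mul]
        _ = (w ^ 2 * D2) * e ^ 2 := by ring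
        _ ≤ _ := by gcongr
    have bQ' : w ^ 2 * |Q| ≤ (G * (x + K₂) + 2 * G * K₄) * e := by
      have i1 : G / w = G * e := by rw [he]; ring
      rw [i1] at bQ
      calc w ^ 2 * |Q| ≤ w ^ 2 * (G * e * ((x + K₂) * e ^ 2) + (G * w + G) * (K₄ * e ^ 4)) := by
            have : G * e * D2 + (G * w + G) * D4
              ≤ G * e * ((x + K₂) * e ^ 2) + (G * w + G) * (K₄ * e ^ 4) := by gcongr
            exact mul_le_mul_of_nonneg_left (bQ.trans this) (by positivity)
        _ = (w ^ 2 * e ^ 2) * (G * (x + K₂) * e + G * K₄ * e * (w * e) + G * K₄ * e ^ 2) := by ring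
        _ = G * (x + K₂) * e + G * K₄ * e + G * K₄ * e ^ 2 := by rw [hwe2, hew]; ring
        _ ≤ G * (x + K₂) * e + G * K₄ * e + G * K₄ * e := by gcongr
        _ = _ := by ring
    have b1 : |α * D1 + R| ≤ E₁ * e ^ 2 := by
      calc |α * D1 + R| ≤ |α| * |D1| + |R| := by rw [← abs_mul]; exact abs_add_le _ _
        _ ≤ |α| * (K₁ * e ^ 2) + C₁ * ((x + K₂) * e ^ 2) := by
          have := mul_le_mul_of_nonneg_left c2' hC₁
          gcongr
          linarith
        _ = _ := by rw [hE₁]; ring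
    have b2 : |β * D1 + S| ≤ E₂ * e ^ 2 := by
      calc |β * D1 + S| ≤ |β| * |D1| + |S| := by rw [← abs_mul]; exact abs_add_le _ _
        _ ≤ |β| * (K₁ * e ^ 2) + C₂ * ((x + K₂) * e ^ 2) := by
          have := mul_le_mul_of_nonneg_left c2' hC₂
          gcongr
          linarith
        _ = _ := by rw [hE₂]; ring
    have hE₁0 : 0 ≤ E₁ := by positivity
    have hE₂0 : 0 ≤ E₂ := by positivity
    have b3 : w ^ 2 * (|α * D1 + R| * |β * D1 + S|) ≤ E₁ * E₂ * e := by
      calc w ^ 2 * (|α * D1 + R| * |β * D1 + S|) ≤ w ^ 2 * ((E₁ * e ^ 2) * (E₂ * e ^ 2)) := by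
            gcongr
        _ = (w ^ 2 * e ^ 2) * (E₁ * E₂ * e ^ 2) := by ring
        _ = E₁ * E₂ * e ^ 2 := by rw [hwe2, one_mul]
        _ ≤ _ := by gcongr
    have b4 : |α * β| * |w ^ 2 * D2 - x| ≤ |α * β| * K₂ * e := by
      rw [mul_assoc]
      gcongr
      exact m2'.trans (by gcongr)
    have key : w ^ 2 * (μ x * ν x + ((μ x * β + ν x * α) * D1 + (α * β * D2 + (μ x * S +
        (ν x * R + Q)))) - (μ x + (α * D1 + R)) * (ν x + (β * D1 + S))) - x * α * β
        = (α * β) * (w ^ 2 * D2 - x) + w ^ 2 * Q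
          - w ^ 2 * ((α * D1 + R) * (β * D1 + S)) := by ring
    rw [key]
    have w2 : |w ^ 2| = w ^ 2 := abs_of_nonneg (by positivity)
    calc _ ≤ |α * β| * |w ^ 2 * D2 - x| + w ^ 2 * |Q|
          + w ^ 2 * (|α * D1 + R| * |β * D1 + S|) := by
          have t1 := abs_sub ((α * β) * (w ^ 2 * D2 - x) + w ^ 2 * Q)
            (w ^ 2 * ((α * D1 + R) * (β * D1 + S)))
          have t2 := abs_add_le ((α * β) * (w ^ 2 * D2 - x)) (w ^ 2 * Q)
          rw [abs_mul (w ^ 2), abs_mul (α * D1 + R), w2] at t1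
          rw [abs_mul (α * β), abs_mul (w ^ 2), w2] at t2
          linarith
      _ ≤ K * e := by rw [hK]; linarith
  rw [tendsto_iff_norm_sub_tendsto_zero]
  have hlim : Tendsto (fun m : ℕ => K * (1 / Real.sqrt m)) atTop (nhds 0) := by
    have h1 : Tendsto (fun m : ℕ => Real.sqrt m) atTop atTop :=
      Real.tendsto_sqrt_atTop.comp tendsto_natCast_atTop_atTop
    have h2 := (h1.inv_tendsto_atTop).const_mul K
    simpa using h2
  refine squeeze_zero' (Eventually.of_forall fun _ => norm_nonneg _) ?_ hlim
  filter_upwards [eventually_ge_atTop 1] with m hm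
  exact main m hm
end
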